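/- Suppose x_1,…,x_n ∈ ℝ^d and y_1,…,y_n ∈ ℝ^d satisfy: (i) Σ_{j ∈ N_i}(x_j − x_i) = 0 for every i ∈ {1,…,n}; (ii) ∇f_i(x_i) + Σ_{j ∈ N_i}(x_i − x_j) + y_i = 0 for every i ∈ {1,…,n}; and (iii) Σ_{i=1}^n y_i = 0. Then x_i = x* for every i, and y_i = −∇f_i(x*) for every i. -/

import Mathlib

open scoped BigOperators

/-- A family of vectors annihilated by the Laplacian of a connected graph is constant. -/
lemma SimpleGraph.Connected.eq_of_sum_neighborFinset_sub_eq_zero {V ι : Type*} [Fintype V]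
    [DecidableEq V] {G : SimpleGraph V} [DecidableRel G.Adj] (hG : G.Connected)
    {x : V → EuclideanSpace ℝ ι} (hx : ∀ i, ∑ j ∈ G.neighborFinset i, (x j - x i) = 0) (i j : V) :
    x i = x j := by
  ext k
  have hker : (G.lapMatrix ℝ).mulVec (fun i => x i k) = 0 := by
    ext a
    have h : ∑ b ∈ G.neighborFinset a, (x b k - x a k) = 0 := by
      simpa using congrArg (fun v : EuclideanSpace ℝ ι => v k) (hx a)
    rw [Finset.sum_sub_distrib, Finset.sum_const, SimpleGraph.card_neighborFinset_eq_degree,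
      nsmul_eq_mul] at h
    rw [SimpleGraph.lapMatrix_mulVec_apply, Pi.zero_apply]
    linarith
  exact (G.lapMatrix_mulVec_eq_zero_iff_forall_reachable).1 hker i j (hG.preconnected i j)

/-- The first-order inequality for convex functions. -/
lemma ConvexOn.add_inner_gradient_le {E : Type*} [NormedAddCommGroup E] [InnerProductSpace ℝ E]
    [CompleteSpace E] {f : E → ℝ} (hf : ConvexOn ℝ Set.univ f) {a : E}
    (ha : DifferentiableAt ℝ f a) (b : E) :
    f a + inner ℝ (gradient f a) (b - a) ≤ f b := by
  have hconv : ConvexOn ℝ Set.univ (f ∘ AffineMap.lineMap a b : ℝ → ℝ) := by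
    simpa using hf.comp_affineMap (AffineMap.lineMap a b : ℝ →ᵃ[ℝ] E)
  have hderiv : HasDerivAt (f ∘ AffineMap.lineMap a b : ℝ → ℝ)
      (inner ℝ (gradient f a) (b - a)) 0 := by
    have h : HasFDerivAt f (InnerProductSpace.toDual ℝ E (gradient f a))
        (AffineMap.lineMap a b (0 : ℝ)) := by
      simpa using ha.hasGradientAt.hasFDerivAt
    simpa using h.comp_hasDerivAt (0 : ℝ) AffineMap.hasDerivAt_lineMap
  have h := hconv.le_slope_of_hasDerivAt (Set.mem_univ 0) (Set.mem_univ 1) one_pos hderiv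
  simp only [slope_def_field, Function.comp_apply, AffineMap.lineMap_apply_zero,
    AffineMap.lineMap_apply_one, sub_zero, div_one] at h
  linarith

/-- Uniqueness of the equilibrium of the distributed mirror descent dynamics with
integral feedback: at an equilibrium all agents agree on the global minimizer
`x*`, and `y_i = −∇f_i(x*)`. -/
theorem dmd_equilibrium_unique
    (n d : ℕ) (G : SimpleGraph (Fin n)) [DecidableRel G.Adj]
    (hconn : G.Connected)
    (f : Fin n → EuclideanSpace ℝ (Fin d) → ℝ)
    (hfconv : ∀ i, ConvexOn ℝ Set.univ (f i))
    (hfdiff : ∀ i x, DifferentiableAt ℝ (f i) x)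
    (σ : ℝ) (hσ : 0 < σ)
    (hFstrong : ConvexOn ℝ Set.univ
      (fun x : EuclideanSpace ℝ (Fin d) => (∑ i, f i x) - σ / 2 * ‖x‖ ^ 2))
    (xstar : EuclideanSpace ℝ (Fin d))
    (hmin : ∀ w, (∑ i, f i xstar) ≤ ∑ i, f i w)
    (huniq : ∀ w, (∀ w', (∑ i, f i w) ≤ ∑ i, f i w') → w = xstar)
    (x y : Fin n → EuclideanSpace ℝ (Fin d))
    (h1 : ∀ i, (∑ j ∈ G.neighborFinset i, (x j - x i)) = 0)
    (h2 : ∀ i, gradient (f i) (x i) + (∑ j ∈ G.neighborFinset i, (x i - x j)) + y i = 0)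
    (h3 : (∑ i, y i) = 0) :
    ∀ i, x i = xstar ∧ y i = -gradient (f i) xstar := by
  have hcons := hconn.eq_of_sum_neighborFinset_sub_eq_zero h1
  have hy : ∀ i, y i = -gradient (f i) (x i) := fun i => by
    have h := h2 i
    rw [Finset.sum_eq_zero fun j _ => sub_eq_zero.2 (hcons i j), add_zero] at h
    exact eq_neg_of_add_eq_zero_right h
  have hx : ∀ i, x i = xstar := fun i => by
    refine huniq _ fun w => ?_
    have hgrad : ∑ j, gradient (f j) (x i) = 0 := by
      rw [← neg_eq_zero, ← Finset.sum_neg_distrib, ← h3]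
      exact Finset.sum_congr rfl fun j _ => by rw [hy j, hcons i j]
    calc ∑ j, f j (x i)
        = ∑ j, (f j (x i) + inner ℝ (gradient (f j) (x i)) (w - x i)) := by
          rw [Finset.sum_add_distrib, ← sum_inner, hgrad, inner_zero_left, add_zero]
      _ ≤ ∑ j, f j w :=
          Finset.sum_le_sum fun j _ => (hfconv j).add_inner_gradient_le (hfdiff j _) w
  exact fun i => ⟨hx i, by rw [hy i, hx i]⟩
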